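/- For all integers n ≥ 2 and k ≥ 1, the following identity holds in F: G_{n,k} = Σ_{i=1}^{min(k,n)} (−1)^{i−1}·q^{n−2i+1}·s_{λ^i_k}, where λ^i_k is the hook partition whose parts are (k−i+1, 1, …, 1, 0, …, 0) with the entry 1 repeated i−1 times and 0 repeated n−i times. -/

import Mathlib

open scoped BigOperators

noncomputable section

abbrev Kq : Type := RatFunc ℚ
abbrev Pn (n : ℕ) : Type := MvPolynomial (Fin n) Kq
abbrev Fn (n : ℕ) : Type := FractionRing (Pn n)

noncomputable def qq (n : ℕ) : Fn n :=
  algebraMap (Pn n) (Fn n) (MvPolynomial.C RatFunc.X)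

noncomputable def L (n : ℕ) (i : Fin n) : Fn n :=
  algebraMap (Pn n) (Fn n) (MvPolynomial.X i)

noncomputable def P (n : ℕ) (S : Finset (Fin n)) (i : Fin n) : Fn n :=
  ∏ j ∈ S.erase i, (qq n * L n i - (qq n)⁻¹ * L n j) / (L n i - L n j)

noncomputable def G (n : ℕ) (S : Finset (Fin n)) (k : ℕ) : Fn n :=
  ∑ i ∈ S, (L n i) ^ k * P n S i

def pset (n m : ℕ) : Finset (Fin n) := Finset.univ.filter fun j => (j : ℕ) < m

/-- The Schur polynomial (as an element of `F`) attached to a partition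
`lam : Fin n → ℕ`, given by the bialternant formula
`s_λ = (∑_{σ ∈ S_n} sign(σ)·∏_j L_{σ(j)}^{λ_j + n - j}) / ∏_{i<j} (L_i - L_j)`
(indices `j` are 0-based here, so the exponent is `λ_j + (n - 1 - j)`). -/
noncomputable def schur (n : ℕ) (lam : Fin n → ℕ) : Fn n :=
  (∑ σ : Equiv.Perm (Fin n),
      ((Equiv.Perm.sign σ : ℤ) : Fn n) *
        ∏ j : Fin n, (L n (σ j)) ^ (lam j + (n - 1 - (j : ℕ)))) /
    ∏ p ∈ Finset.univ.filter (fun p : Fin n × Fin n => p.1 < p.2), (L n p.1 - L n p.2)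

namespace Alternant

variable {K : Type*} [Field K] {n : ℕ}

/-- The alternant `det (x i ^ e j)`. -/
def alternant (x : Fin n → K) (e : Fin n → ℕ) : K :=
  (Matrix.of fun i j => x i ^ e j).det

theorem alternant_eq_sum (x : Fin n → K) (e : Fin n → ℕ) :
    alternant x e = ∑ σ : Equiv.Perm (Fin n),
      ((Equiv.Perm.sign σ : ℤ) : K) * ∏ j, x (σ j) ^ e j := by
  simp [alternant, Matrix.det_apply']

theorem alternant_comp_perm (x : Fin n → K) (e : Fin n → ℕ) (σ : Equiv.Perm (Fin n)) :
    alternant x (e ∘ σ) = ((Equiv.Perm.sign σ : ℤ) : K) * alternant x e :=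
  Matrix.det_permute' σ (Matrix.of fun i j => x i ^ e j)

theorem alternant_eq_zero (x : Fin n → K) (e : Fin n → ℕ) {a b : Fin n} (hab : a ≠ b)
    (h : e a = e b) : alternant x e = 0 :=
  Matrix.det_zero_of_column_eq hab fun i => by simp [h]

/-- The pairs `(i, j)` with `i < j`. -/
def pairs (n : ℕ) : Finset (Fin n × Fin n) := Finset.univ.filter fun p => p.1 < p.2

theorem alternant_staircase (x : Fin n → K) :
    alternant x (fun j => n - 1 - (j : ℕ)) = ∏ p ∈ pairs n, (x p.1 - x p.2) := by
  have h : (Matrix.of fun (i j : Fin n) => x i ^ (n - 1 - (j : ℕ))) =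
      Matrix.projVandermonde (fun _ => 1) x := by
    ext i j
    rw [Matrix.projVandermonde_apply, Matrix.of_apply, Fin.val_rev]
    simp only [one_pow, one_mul]
    congr 1
    omega
  rw [alternant, h, Matrix.det_projVandermonde, pairs, Finset.prod_filter, Fintype.prod_prod_type]
  refine Finset.prod_congr rfl fun i _ => ?_
  rw [← Finset.prod_filter]
  refine Finset.prod_congr (by ext; simp) fun j _ => by simp

/-- A product over pairs that is trivial away from the index `i` reduces to a product
over the other indices. -/
theorem prod_pairs_eq_prod_erase (g : Fin n → Fin n → K) (i : Fin n)
    (hsymm : ∀ a b, g a b = g b a) (hone : ∀ a b, a < b → a ≠ i → b ≠ i → g a b = 1) :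
    ∏ p ∈ pairs n, g p.1 p.2 = ∏ j ∈ Finset.univ.erase i, g i j := by
  symm
  refine Finset.prod_of_injOn (fun j => if i < j then (i, j) else (j, i)) ?_ ?_ ?_ ?_
  · intro a ha b hb hab
    simp only at hab
    split_ifs at hab <;> simp_all
  · intro a ha
    have : a ≠ i := by simpa using ha
    simp only [pairs, Finset.coe_filter, Finset.mem_univ, true_and, Set.mem_ofPred_eq]
    split_ifs with h
    · exact h
    · exact lt_of_le_of_ne (not_lt.mp h) this
  · rintro ⟨a, b⟩ hp hn
    have hlt : a < b := by simpa [pairs] using hp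
    refine hone a b hlt ?_ ?_
    · rintro rfl
      exact hn ⟨b, by simpa using hlt.ne', by simp [hlt]⟩
    · rintro rfl
      exact hn ⟨a, by simpa using hlt.ne, by simp [hlt.le]⟩
  · intro j _
    split_ifs
    · rfl
    · exact hsymm _ _

theorem prod_div_eq_alternant_update (x : Fin n → K) (hx : Function.Injective x) (t : K)
    (i : Fin n) :
    ∏ j ∈ Finset.univ.erase i, (t * x i - x j) / (x i - x j) =
      alternant (Function.update x i (t * x i)) (fun j => n - 1 - (j : ℕ)) /
        ∏ p ∈ pairs n, (x p.1 - x p.2) := by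
  rw [alternant_staircase, ← Finset.prod_div_distrib]
  set y := Function.update x i (t * x i) with hy
  rw [prod_pairs_eq_prod_erase (fun a b => (y a - y b) / (x a - x b)) i]
  · refine Finset.prod_congr rfl fun j hj => ?_
    have : j ≠ i := by simpa using hj
    simp [hy, this]
  · intro a b
    rw [← neg_sub (y b), ← neg_sub (x b), neg_div_neg_eq]
  · intro a b hab ha hb
    have : x a - x b ≠ 0 := sub_ne_zero.mpr (hx.ne hab.ne)
    simp [hy, ha, hb, this]

theorem sum_pow_mul_alternant_update (x : Fin n → K) (t : K) (k : ℕ) (e : Fin n → ℕ) :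
    ∑ i, x i ^ k * alternant (Function.update x i (t * x i)) e =
      ∑ r : Fin n, t ^ e r * alternant x (fun j => e j + if (j : ℕ) = r then k else 0) := by
  simp only [alternant_eq_sum, Finset.mul_sum]
  rw [Finset.sum_comm, Finset.sum_comm (s := Finset.univ (α := Fin n))]
  refine Finset.sum_congr rfl fun σ _ => ?_
  rw [← Equiv.sum_comp σ]
  refine Finset.sum_congr rfl fun r _ => ?_
  have h1 : ∏ j, Function.update x (σ r) (t * x (σ r)) (σ j) ^ e j =
      t ^ e r * ∏ j, x (σ j) ^ e j := by
    rw [← Finset.mul_prod_erase _ _ (Finset.mem_univ r),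
      ← Finset.mul_prod_erase _ (fun j => x (σ j) ^ e j) (Finset.mem_univ r),
      Function.update_self, mul_pow, mul_assoc]
    congr 2
    refine Finset.prod_congr rfl fun j hj => ?_
    rw [Function.update_of_ne (σ.injective.ne (Finset.ne_of_mem_erase hj))]
  have h2 : ∏ j, x (σ j) ^ (e j + if (j : ℕ) = r then k else 0) =
      x (σ r) ^ k * ∏ j, x (σ j) ^ e j := by
    simp only [pow_add, Finset.prod_mul_distrib, Fin.val_inj, pow_ite, pow_zero,
      Finset.prod_ite_eq', Finset.mem_univ, if_true]
    ring
  rw [h1, h2]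
  ring

theorem alternant_staircase_add_of_lt (x : Fin n → K) {k r : ℕ} (hr : r < n) (hrk : r < k) :
    alternant x (fun j => n - 1 - (j : ℕ) + if (j : ℕ) = r then k else 0) =
      (-1) ^ r * alternant x (fun j => (if (j : ℕ) = 0 then k - (r + 1) + 1 else
        if (j : ℕ) < r + 1 then 1 else 0) + (n - 1 - (j : ℕ))) := by
  have : NeZero n := ⟨by omega⟩
  have hs : (((Equiv.Perm.sign (Fin.cycleRange ⟨r, hr⟩) : ℤˣ) : ℤ) : K) = (-1) ^ r := by
    simp [Fin.sign_cycleRange]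
  rw [← hs, ← alternant_comp_perm]
  congr 1
  ext j
  simp only [Function.comp_apply]
  rcases lt_trichotomy (j : ℕ) r with h | h | h
  · rw [Fin.coe_cycleRange_of_lt (Fin.lt_def.mpr h)]
    simp only [h.ne, Nat.succ_ne_zero, add_lt_add_iff_right, h, if_true, if_false]
    omega
  · have : j = ⟨r, hr⟩ := Fin.ext h
    subst this
    simp only [Fin.cycleRange_self, Fin.val_zero, if_true]
    omega
  · rw [Fin.cycleRange_of_gt (Fin.lt_def.mpr h)]
    split_ifs <;> omega

theorem alternant_staircase_add_of_le (x : Fin n → K) {k r : ℕ} (hr : r < n) (hk : 1 ≤ k)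
    (hkr : k ≤ r) :
    alternant x (fun j => n - 1 - (j : ℕ) + if (j : ℕ) = r then k else 0) = 0 := by
  refine alternant_eq_zero x _ (a := ⟨r, hr⟩) (b := ⟨r - k, by omega⟩) ?_ ?_
  · simp only [ne_eq, Fin.mk.injEq]
    omega
  · simp only [if_true]
    split_ifs <;> omega

end Alternant

open Alternant

theorem L_injective (n : ℕ) : Function.Injective (L n) :=
  (IsFractionRing.injective (Pn n) (Fn n)).comp (MvPolynomial.X_injective (R := Kq))

theorem qq_ne_zero (n : ℕ) : qq n ≠ 0 := by
  have h : (MvPolynomial.C RatFunc.X : Pn n) ≠ 0 :=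
    (map_ne_zero_iff _ (MvPolynomial.C_injective _ _)).mpr RatFunc.X_ne_zero
  exact (map_ne_zero_iff _ (IsFractionRing.injective (Pn n) (Fn n))).mpr h

theorem schur_eq_alternant_div (n : ℕ) (lam : Fin n → ℕ) :
    schur n lam = alternant (L n) (fun j => lam j + (n - 1 - (j : ℕ))) /
      ∏ p ∈ pairs n, (L n p.1 - L n p.2) := by
  rw [alternant_eq_sum]
  rfl

theorem P_univ_eq (n : ℕ) (i : Fin n) :
    P n Finset.univ i = (qq n)⁻¹ ^ (n - 1) *
      (alternant (Function.update (L n) i (qq n ^ 2 * L n i)) (fun j => n - 1 - (j : ℕ)) /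
        ∏ p ∈ pairs n, (L n p.1 - L n p.2)) := by
  have hq := qq_ne_zero n
  have hcard : (Finset.univ.erase i).card = n - 1 := by simp
  rw [← prod_div_eq_alternant_update _ (L_injective n), P, ← hcard, ← Finset.prod_const,
    ← Finset.prod_mul_distrib]
  refine Finset.prod_congr rfl fun j _ => ?_
  rw [← mul_div_assoc]
  congr 1
  field_simp

theorem G_univ_eq_sum_alternant (n k : ℕ) :
    G n Finset.univ k = ∑ r ∈ Finset.range n, qq n ^ ((n : ℤ) - 2 * r - 1) *
      (alternant (L n) (fun j => n - 1 - (j : ℕ) + if (j : ℕ) = r then k else 0) /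
        ∏ p ∈ pairs n, (L n p.1 - L n p.2)) := by
  have hq := qq_ne_zero n
  have h := sum_pow_mul_alternant_update (L n) (qq n ^ 2) k (fun j => n - 1 - (j : ℕ))
  have hG : G n Finset.univ k = (qq n)⁻¹ ^ (n - 1) *
      ((∑ i, L n i ^ k * alternant (Function.update (L n) i (qq n ^ 2 * L n i))
        (fun j => n - 1 - (j : ℕ))) / ∏ p ∈ pairs n, (L n p.1 - L n p.2)) := by
    rw [G, Finset.sum_div, Finset.mul_sum]
    refine Finset.sum_congr rfl fun i _ => ?_
    rw [P_univ_eq]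
    ring
  rw [hG, h, Finset.sum_div, Finset.mul_sum, Finset.sum_range]
  refine Finset.sum_congr rfl fun r _ => ?_
  have hpow : qq n ^ ((n : ℤ) - 2 * (r : ℕ) - 1) =
      (qq n)⁻¹ ^ (n - 1) * (qq n ^ 2) ^ (n - 1 - (r : ℕ)) := by
    rw [inv_pow, ← pow_mul, ← zpow_natCast, ← zpow_natCast, ← zpow_neg, ← zpow_add₀ hq]
    congr 1
    have := r.isLt
    omega
  rw [hpow]
  ring

/-- For `n ≥ 2`, `k ≥ 1`:
`G_{n,k} = ∑_{i=1}^{min(k,n)} (-1)^{i-1}·q^{n-2i+1}·s_{λ^i_k}`, where `λ^i_k` is the hook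
partition `(k-i+1, 1, …, 1, 0, …, 0)` with `1` repeated `i-1` times. -/
theorem stmt_7 (n k : ℕ) (hn : 2 ≤ n) (hk : 1 ≤ k) :
    G n Finset.univ k =
      ∑ i ∈ Finset.Icc 1 (min k n),
        (-1 : Fn n) ^ (i - 1) * (qq n) ^ ((n : ℤ) - 2 * (i : ℤ) + 1) *
          schur n (fun j => if (j : ℕ) = 0 then k - i + 1 else if (j : ℕ) < i then 1 else 0) := by
  rw [G_univ_eq_sum_alternant,
    ← Finset.sum_subset (Finset.range_subset_range.mpr (min_le_right k n))]
  · refine Finset.sum_nbij' (fun r => r + 1) (fun i => i - 1) ?_ ?_ ?_ ?_ ?_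
    · intro r hr
      simp only [Finset.mem_range, Finset.mem_Icc] at *
      omega
    · intro i hi
      simp only [Finset.mem_range, Finset.mem_Icc] at *
      omega
    · intro r _
      exact Nat.add_sub_cancel r 1
    · intro i hi
      exact Nat.sub_add_cancel (Finset.mem_Icc.mp hi).1
    · intro r hr
      obtain ⟨hrk, hrn⟩ := lt_min_iff.mp (Finset.mem_range.mp hr)
      rw [schur_eq_alternant_div, alternant_staircase_add_of_lt _ hrn hrk, Nat.add_sub_cancel,
        show (n : ℤ) - 2 * ((r + 1 : ℕ) : ℤ) + 1 = (n : ℤ) - 2 * r - 1 by push_cast; ring]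
      ring
  · intro r hr hr'
    have hrn := Finset.mem_range.mp hr
    have hkr : k ≤ r := by
      simp only [Finset.mem_range] at hr'
      omega
    rw [alternant_staircase_add_of_le _ hrn hk hkr, zero_div, mul_zero]
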